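/- Let n ≥ 4 and let B be a saturated blocker of the convex n-gon. If the vertex i is contained in exactly one edge of B, namely the edge {i,j}, then the ear-cover {j−1,j+1} belongs to B. -/

import Mathlib

open Finset

namespace ConvexBlocker

/-- `c` lies strictly inside the (positively oriented) open arc from `a` to `b`. -/
def Btw (n : ℕ) (a c b : ZMod n) : Prop :=
  0 < (c - a).val ∧ (c - a).val < (b - a).val

/-- Two edges of the convex `n`-gon cross: their endpoints are four pairwise distinct
vertices which interleave in the cyclic order. -/
def Cross (n : ℕ) (e f : Sym2 (ZMod n)) : Prop :=
  ∃ a b c d : ZMod n, e = s(a, b) ∧ f = s(c, d) ∧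
    0 < (c - a).val ∧ (c - a).val < (b - a).val ∧ (b - a).val < (d - a).val

/-- `e` is an edge (an unordered pair of distinct vertices) of the `n`-gon. -/
def IsEdge (n : ℕ) (e : Sym2 (ZMod n)) : Prop :=
  ∃ a b : ZMod n, e = s(a, b) ∧ a ≠ b

/-- `e` is a diagonal of the convex `n`-gon: an edge of order at least 2, i.e. both open
arcs between its endpoints are nonempty. -/
def IsDiagonal (n : ℕ) (e : Sym2 (ZMod n)) : Prop :=
  ∃ a b : ZMod n, e = s(a, b) ∧ a ≠ b ∧ (∃ c, Btw n a c b) ∧ (∃ d, Btw n b d a)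

/-- A triangulation of the convex `n`-gon: an inclusion-maximal set of pairwise
non-crossing diagonals. -/
def IsTriangulation (n : ℕ) (T : Finset (Sym2 (ZMod n))) : Prop :=
  (∀ e ∈ T, IsDiagonal n e) ∧
  (∀ e ∈ T, ∀ f ∈ T, ¬ Cross n e f) ∧
  (∀ e, IsDiagonal n e → e ∉ T → ∃ f ∈ T, Cross n e f)

/-- A blocker of the convex `n`-gon: a set of edges meeting every triangulation. -/
def IsBlocker (n : ℕ) (B : Finset (Sym2 (ZMod n))) : Prop :=
  (∀ e ∈ B, IsEdge n e) ∧
  ∀ T : Finset (Sym2 (ZMod n)), IsTriangulation n T → (B ∩ T).Nonempty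

/-- A saturated blocker of the convex `n`-gon. -/
def IsSaturatedBlocker (n : ℕ) (B : Finset (Sym2 (ZMod n))) : Prop :=
  IsBlocker n B ∧ ∀ e ∈ B, ¬ IsBlocker n (B.erase e)

/-- `e` is an edge of the sub-polygon on the vertex set `S`. -/
def IsEdgeOn (n : ℕ) (S : Finset (ZMod n)) (e : Sym2 (ZMod n)) : Prop :=
  ∃ a b : ZMod n, e = s(a, b) ∧ a ∈ S ∧ b ∈ S ∧ a ≠ b

/-- `e` is a diagonal of the sub-polygon on `S` (with the inherited cyclic order):
its endpoints are distinct members of `S` which are not cyclically consecutive in `S`. -/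
def IsDiagonalOn (n : ℕ) (S : Finset (ZMod n)) (e : Sym2 (ZMod n)) : Prop :=
  ∃ a b : ZMod n, e = s(a, b) ∧ a ∈ S ∧ b ∈ S ∧ a ≠ b ∧
    (∃ c ∈ S, Btw n a c b) ∧ (∃ d ∈ S, Btw n b d a)

/-- A triangulation of the sub-polygon on `S`. -/
def IsTriangulationOn (n : ℕ) (S : Finset (ZMod n)) (T : Finset (Sym2 (ZMod n))) : Prop :=
  (∀ e ∈ T, IsDiagonalOn n S e) ∧
  (∀ e ∈ T, ∀ f ∈ T, ¬ Cross n e f) ∧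
  (∀ e, IsDiagonalOn n S e → e ∉ T → ∃ f ∈ T, Cross n e f)

/-- A blocker of the sub-polygon on `S`. -/
def IsBlockerOn (n : ℕ) (S : Finset (ZMod n)) (B : Finset (Sym2 (ZMod n))) : Prop :=
  (∀ e ∈ B, IsEdgeOn n S e) ∧
  ∀ T : Finset (Sym2 (ZMod n)), IsTriangulationOn n S T → (B ∩ T).Nonempty

/-- A saturated blocker of the sub-polygon on `S`. -/
def IsSaturatedBlockerOn (n : ℕ) (S : Finset (ZMod n)) (B : Finset (Sym2 (ZMod n))) : Prop :=
  IsBlockerOn n S B ∧ ∀ e ∈ B, ¬ IsBlockerOn n S (B.erase e)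

/-- The degree of the vertex `v` in the set of edges `B`. -/
noncomputable def degB (n : ℕ) (B : Finset (Sym2 (ZMod n))) (v : ZMod n) : ℕ :=
  (B.filter (fun e => v ∈ e)).card

end ConvexBlocker

namespace ConvexBlocker

theorem val_sub_eq_ite {n : ℕ} [NeZero n] (i x y : ZMod n) :
    (x - y).val = if (y - i).val ≤ (x - i).val then (x - i).val - (y - i).val
      else n + (x - i).val - (y - i).val := by
  split_ifs with h
  · rw [← ZMod.val_sub h, sub_sub_sub_cancel_right]
  · have hyx : (y - x).val = (y - i).val - (x - i).val := by
      rw [← ZMod.val_sub (by omega), sub_sub_sub_cancel_right]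
    have hne : y - x ≠ 0 := fun h0 => by
      rw [h0, ZMod.val_zero] at hyx
      omega
    have hlt := ZMod.val_lt (y - i)
    rw [← neg_sub y x, ZMod.neg_val, if_neg hne, hyx]
    omega

theorem exists_val_sub_eq {n : ℕ} [NeZero n] (i : ZMod n) {m : ℕ} (hm : m < n) :
    ∃ x : ZMod n, (x - i).val = m :=
  ⟨m + i, by rw [add_sub_cancel_right, ZMod.val_natCast_of_lt hm]⟩

theorem eq_of_val_sub_eq {n : ℕ} [NeZero n] {i x y : ZMod n}
    (h : (x - i).val = (y - i).val) : x = y :=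
  sub_left_injective (ZMod.val_injective n h)

theorem btw_iff {n : ℕ} [NeZero n] (i a c b : ZMod n) :
    Btw n a c b ↔
      ((a - i).val < (c - i).val ∧ (c - i).val < (b - i).val) ∨
      ((c - i).val < (b - i).val ∧ (b - i).val < (a - i).val) ∨
      ((b - i).val < (a - i).val ∧ (a - i).val < (c - i).val) := by
  have ha := ZMod.val_lt (a - i)
  have hb := ZMod.val_lt (b - i)
  have hc := ZMod.val_lt (c - i)
  rw [Btw, val_sub_eq_ite i c a, val_sub_eq_ite i b a]
  split_ifs <;> omega

theorem isDiagonal_mk_iff {n : ℕ} [NeZero n] (i a b : ZMod n) :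
    IsDiagonal n s(a, b) ↔
      min (a - i).val (b - i).val + 2 ≤ max (a - i).val (b - i).val ∧
      max (a - i).val (b - i).val + 2 ≤ n + min (a - i).val (b - i).val := by
  have ha := ZMod.val_lt (a - i)
  have hb := ZMod.val_lt (b - i)
  constructor
  · rintro ⟨x, y, he, -, ⟨c, hc⟩, ⟨d, hd⟩⟩
    have hc' := ZMod.val_lt (c - i)
    have hd' := ZMod.val_lt (d - i)
    rw [btw_iff i] at hc hd
    rcases Sym2.eq_iff.1 he with ⟨rfl, rfl⟩ | ⟨rfl, rfl⟩ <;> omega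
  · rintro ⟨h1, h2⟩
    have key : ∀ x y : ZMod n, 2 ≤ (y - x).val → ∃ c, Btw n x c y := fun x y h => by
      obtain ⟨c, hc⟩ := exists_val_sub_eq x (m := 1) (by have := ZMod.val_lt (y - x); omega)
      exact ⟨c, by omega, by omega⟩
    refine ⟨a, b, rfl, ?_, key _ _ ?_, key _ _ ?_⟩
    · rintro rfl
      omega
    · rw [val_sub_eq_ite i]
      split_ifs <;> omega
    · rw [val_sub_eq_ite i]
      split_ifs <;> omega

/-- Two edges cross exactly when, in the linear order of the vertices starting at `i`, one
endpoint of the second lies strictly between those of the first and the other strictly outside. -/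
theorem cross_mk_iff_interleave {n : ℕ} [NeZero n] (i a b c d : ZMod n) :
    Cross n s(a, b) s(c, d) ↔
      let lo := min (a - i).val (b - i).val
      let hi := max (a - i).val (b - i).val
      (lo < (c - i).val ∧ (c - i).val < hi ∧ ((d - i).val < lo ∨ hi < (d - i).val)) ∨
      (lo < (d - i).val ∧ (d - i).val < hi ∧ ((c - i).val < lo ∨ hi < (c - i).val)) := by
  have cross_of_btw : ∀ c d : ZMod n, Btw n a c b → Btw n a b d → Cross n s(a, b) s(c, d) :=
    fun c d hc hd => ⟨a, b, c, d, rfl, rfl, hc.1, hc.2, hd.2⟩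
  constructor
  · rintro ⟨x, y, z, w, he, hf, h0, h1, h2⟩
    have hz : Btw n x z y := ⟨h0, h1⟩
    have hw : Btw n x y w := ⟨h0.trans h1, h2⟩
    rw [btw_iff i] at hz hw
    dsimp only
    rcases Sym2.eq_iff.1 he with ⟨rfl, rfl⟩ | ⟨rfl, rfl⟩ <;>
      rcases Sym2.eq_iff.1 hf with ⟨rfl, rfl⟩ | ⟨rfl, rfl⟩ <;> omega
  · intro h
    by_cases hcb : Btw n a c b
    · refine cross_of_btw c d hcb ?_
      rw [btw_iff i] at hcb ⊢
      omega
    · rw [Sym2.eq_swap (a := c)]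
      apply cross_of_btw d c <;> rw [btw_iff i] at hcb ⊢ <;> omega

theorem val_add_one_sub_of_isDiagonal {n : ℕ} [NeZero n] {i j : ZMod n}
    (h : IsDiagonal n s(i, j)) :
    (j + 1 - i).val = (j - i).val + 1 ∧ (j - 1 - i).val + 1 = (j - i).val := by
  rw [isDiagonal_mk_iff i, sub_self, ZMod.val_zero] at h
  have h1 := val_sub_eq_ite i (j + 1) j
  have h2 := val_sub_eq_ite i j (j - 1)
  have := ZMod.val_lt (j - i)
  have := ZMod.val_lt (j + 1 - i)
  have := ZMod.val_lt (j - 1 - i)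
  have : Fact (1 < n) := ⟨by omega⟩
  rw [add_sub_cancel_left, ZMod.val_one] at h1
  rw [sub_sub_cancel, ZMod.val_one] at h2
  split_ifs at h1 h2 <;> omega

open Classical in
/-- All diagonals at `i`, with `{i, j}` (if it is a diagonal) flipped to `{j - 1, j + 1}`. -/
noncomputable def flippedStar (n : ℕ) [NeZero n] (i j : ZMod n) : Finset (Sym2 (ZMod n)) :=
  univ.filter fun e => IsDiagonal n e ∧
    (i ∈ e ∧ e ≠ s(i, j) ∨ e = s(j - 1, j + 1) ∧ IsDiagonal n s(i, j))

theorem mem_flippedStar {n : ℕ} [NeZero n] {i j : ZMod n} {e : Sym2 (ZMod n)} :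
    e ∈ flippedStar n i j ↔ IsDiagonal n e ∧
      (i ∈ e ∧ e ≠ s(i, j) ∨ e = s(j - 1, j + 1) ∧ IsDiagonal n s(i, j)) := by
  simp [flippedStar]

theorem not_cross_of_mem_flippedStar {n : ℕ} [NeZero n] {i j : ZMod n} {e f : Sym2 (ZMod n)}
    (he : e ∈ flippedStar n i j) (hf : f ∈ flippedStar n i j) : ¬ Cross n e f := by
  have hi : (i - i).val = 0 := by rw [sub_self, ZMod.val_zero]
  have hne : ∀ {k : ZMod n}, s(i, k) ≠ s(i, j) → (k - i).val ≠ (j - i).val :=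
    fun hk h => hk (by rw [eq_of_val_sub_eq h])
  obtain ⟨-, ⟨he, he'⟩ | ⟨rfl, hij⟩⟩ := mem_flippedStar.1 he <;>
    obtain ⟨-, ⟨hf, hf'⟩ | ⟨rfl, hij'⟩⟩ := mem_flippedStar.1 hf
  · obtain ⟨k, rfl⟩ := he
    obtain ⟨l, rfl⟩ := hf
    rw [cross_mk_iff_interleave i]
    dsimp only
    omega
  · obtain ⟨k, rfl⟩ := he
    have := hne he'
    have := val_add_one_sub_of_isDiagonal hij'
    rw [cross_mk_iff_interleave i]
    dsimp only
    omega
  · obtain ⟨l, rfl⟩ := hf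
    have := hne hf'
    have := val_add_one_sub_of_isDiagonal hij
    rw [cross_mk_iff_interleave i]
    dsimp only
    omega
  · rw [cross_mk_iff_interleave i]
    dsimp only
    omega

theorem isDiagonal_earCover {n : ℕ} [NeZero n] (hn : 4 ≤ n) {i j : ZMod n}
    (h : IsDiagonal n s(i, j)) : IsDiagonal n s(j - 1, j + 1) := by
  have := val_add_one_sub_of_isDiagonal h
  rw [isDiagonal_mk_iff i]
  omega

theorem exists_cross_of_notMem_flippedStar {n : ℕ} [NeZero n] (hn : 4 ≤ n) {i j : ZMod n}
    {e : Sym2 (ZMod n)} (he : IsDiagonal n e) (heT : e ∉ flippedStar n i j) :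
    ∃ f ∈ flippedStar n i j, Cross n e f := by
  have hi : (i - i).val = 0 := by rw [sub_self, ZMod.val_zero]
  by_cases hij : e = s(i, j)
  · subst hij
    refine ⟨s(j - 1, j + 1),
      mem_flippedStar.2 ⟨isDiagonal_earCover hn he, .inr ⟨rfl, he⟩⟩, ?_⟩
    have := val_add_one_sub_of_isDiagonal he
    rw [isDiagonal_mk_iff i] at he
    rw [cross_mk_iff_interleave i]
    dsimp only
    omega
  have hie : i ∉ e := fun h => heT (mem_flippedStar.2 ⟨he, .inl ⟨h, hij⟩⟩)
  obtain ⟨a, b, rfl, hlt⟩ : ∃ a b, e = s(a, b) ∧ (a - i).val ≤ (b - i).val := by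
    induction e with | _ a b
    rcases le_total (a - i).val (b - i).val with h | h
    exacts [⟨a, b, rfl, h⟩, ⟨b, a, Sym2.eq_swap, h⟩]
  have ha : (a - i).val ≠ 0 := fun h => hie <| by
    rw [eq_of_val_sub_eq (h.trans hi.symm)]
    exact Sym2.mem_mk_left _ _
  have hb := ZMod.val_lt (b - i)
  have hd := (isDiagonal_mk_iff i a b).1 he
  have key : ∀ k : ZMod n, (a - i).val < (k - i).val → (k - i).val < (b - i).val → k ≠ j →
      ∃ f ∈ flippedStar n i j, Cross n s(a, b) f := fun k hak hkb hkj => by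
    refine ⟨s(i, k), mem_flippedStar.2 ⟨?_, .inl ⟨Sym2.mem_mk_left _ _, ?_⟩⟩, ?_⟩
    · rw [isDiagonal_mk_iff i]
      omega
    · exact fun h => hkj (Sym2.congr_right.1 h)
    · rw [cross_mk_iff_interleave i]
      dsimp only
      omega
  obtain ⟨k, hk⟩ := exists_val_sub_eq i (m := (a - i).val + 1) (by omega)
  by_cases hkj : k = j
  · subst hkj
    by_cases hab : (b - i).val = (a - i).val + 2
    · have hik : IsDiagonal n s(i, k) := by
        rw [isDiagonal_mk_iff i]
        omega
      have hk' := val_add_one_sub_of_isDiagonal hik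
      have hak : a = k - 1 := eq_of_val_sub_eq (i := i) (by omega)
      have hbk : b = k + 1 := eq_of_val_sub_eq (i := i) (by omega)
      exact absurd (mem_flippedStar.2 ⟨he, .inr ⟨by rw [hak, hbk], hik⟩⟩) heT
    · obtain ⟨l, hl⟩ := exists_val_sub_eq i (m := (a - i).val + 2) (by omega)
      refine key l (by omega) (by omega) ?_
      rintro rfl
      omega
  · exact key k (by omega) (by omega) hkj

theorem isTriangulation_flippedStar {n : ℕ} [NeZero n] (hn : 4 ≤ n) (i j : ZMod n) :
    IsTriangulation n (flippedStar n i j) :=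
  ⟨fun _ he => (mem_flippedStar.1 he).1, fun _ he _ hf => not_cross_of_mem_flippedStar he hf,
    fun _ => exists_cross_of_notMem_flippedStar hn⟩

end ConvexBlocker

open ConvexBlocker in
/-- if in a saturated blocker `B` the vertex `i` is contained in exactly one edge
of `B`, namely `{i,j}`, then the ear-cover `{j-1,j+1}` belongs to `B`. -/
theorem earcover_of_pendant_vertex
    (n : ℕ) (hn : 4 ≤ n) (B : Finset (Sym2 (ZMod n))) (hB : IsSaturatedBlocker n B)
    (i j : ZMod n) (hmem : s(i, j) ∈ B) (huniq : ∀ e ∈ B, i ∈ e → e = s(i, j)) :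
    s(j - 1, j + 1) ∈ B := by
  have : NeZero n := ⟨by omega⟩
  obtain ⟨e, he⟩ := hB.1.2 _ (isTriangulation_flippedStar hn i j)
  obtain ⟨heB, heT⟩ := Finset.mem_inter.1 he
  obtain ⟨-, ⟨hie, hne⟩ | ⟨rfl, -⟩⟩ := mem_flippedStar.1 heT
  · exact absurd (huniq e heB hie) hne
  · exact heB
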